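/- arXiv:1403.5045 — 4 statements merged into one kernel-verified Lean document; each statement's English description precedes it below -/
import Mathlib

section
/- Let M = (E, I) be a matroid and let A* = {a*_1, ..., a*_K} and A = {a_1, ..., a_K} be two bases of M, each with a fixed enumeration of its elements. Then there exists a bijection π : {1, ..., K} → {1, ..., K} such that for every k = 1, ..., K the set {a_1, ..., a_{k-1}, a*_{π(k)}} is independent in M, and moreover π(k) = i whenever a_k = a*_i for some i (i.e., π fixes the elements common to both bases). -/
/-- A matroid on a finite ground set `E`, given by its family of independent sets. -/
structure FinMatroid (α : Type*) [DecidableEq α] where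
  E : Finset α
  Indep : Finset α → Prop
  indep_subset_ground : ∀ ⦃A : Finset α⦄, Indep A → A ⊆ E
  empty_indep : Indep ∅
  indep_subset : ∀ ⦃A B : Finset α⦄, Indep B → A ⊆ B → Indep A
  augment : ∀ ⦃X Y : Finset α⦄, Indep X → Indep Y → Y.card + 1 = X.card →
    ∃ e ∈ X \ Y, Indep (insert e Y)

/-- A base of a matroid is a maximal independent set. -/
def FinMatroid.Base {α : Type*} [DecidableEq α] (M : FinMatroid α) (B : Finset α) : Prop :=
  M.Indep B ∧ ∀ A : Finset α, M.Indep A → B ⊆ A → A = B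

/-- An independent set `Y` can be extended by elements of an independent set `X`
with at least as many elements to an independent set of the size of `X`. -/
theorem FinMatroid.exists_extension {α : Type*} [DecidableEq α] (M : FinMatroid α)
    {X Y : Finset α} (hX : M.Indep X) (hY : M.Indep Y) (h : Y.card ≤ X.card) :
    ∃ Z, M.Indep Z ∧ Y ⊆ Z ∧ Z ⊆ X ∪ Y ∧ Z.card = X.card := by
  induction hn : X.card - Y.card generalizing Y with
  | zero => exact ⟨Y, hY, subset_rfl, Finset.subset_union_right, by omega⟩
  | succ n ih =>
    obtain ⟨X', hX', hcard⟩ := Finset.exists_subset_card_eq (show Y.card + 1 ≤ X.card by omega)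
    obtain ⟨e, he, hins⟩ := M.augment (M.indep_subset hX hX') hY hcard.symm
    rw [Finset.mem_sdiff] at he
    have hc := Finset.card_insert_of_notMem he.2
    obtain ⟨Z, hZ, hYZ, hZX, hZc⟩ := ih hins (by omega) (by omega)
    refine ⟨Z, hZ, (Finset.subset_insert e Y).trans hYZ, fun z hz => ?_, hZc⟩
    have := hZX hz
    have := hX' he.1
    grind

/-- For any two bases `A* = {a*_1, …, a*_K}` and `A = {a_1, …, a_K}` of a matroid,
there is a bijection `π` of `{1, …, K}` such that `{a_1, …, a_{k-1}, a*_{π(k)}}` is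
independent for every `k`, and `π(k) = i` whenever `a_k = a*_i`. -/
theorem matroid_bijection_indep {α : Type*} [DecidableEq α] (M : FinMatroid α) (K : ℕ)
    (astar a : Fin K → α)
    (hastar_inj : Function.Injective astar) (ha_inj : Function.Injective a)
    (hAstar : M.Base (Finset.image astar Finset.univ))
    (hA : M.Base (Finset.image a Finset.univ)) :
    ∃ π : Equiv.Perm (Fin K),
      (∀ k : Fin K,
        M.Indep (insert (astar (π k)) ((Finset.univ.filter (fun j => j < k)).image a))) ∧
      (∀ k i : Fin K, a k = astar i → π k = i) := by
  classical
  let t : Fin K → Finset (Fin K) := fun k => {i |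
    M.Indep (insert (astar i) ((Finset.univ.filter (fun j => j < k)).image a)) ∧
      ∀ j, a k = astar j → i = j}
  have hall : ∀ S : Finset (Fin K), S.card ≤ (S.biUnion t).card := by
    intro S
    let T : Finset (Fin K) := {k | k ∈ S → ∃ i, a k = astar i}
    have hJ : M.Indep (T.image a) :=
      M.indep_subset hA.1 (Finset.image_subset_image (Finset.subset_univ T))
    have hXc : (Finset.univ.image astar).card = K := by
      simp [Finset.card_image_of_injective _ hastar_inj]
    have hTc : (T.image a).card = T.card := Finset.card_image_of_injective _ ha_inj
    have hTK : T.card ≤ K := by simpa using Finset.card_le_univ T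
    obtain ⟨Z, hZ, hJZ, hZX, hZc⟩ := M.exists_extension hAstar.1 hJ (by omega)
    have hsub : Z \ Sᶜ.image a ⊆ (S.biUnion t).image astar := by
      intro z hz
      rw [Finset.mem_sdiff] at hz
      by_cases hzJ : z ∈ T.image a
      · obtain ⟨k, hk, rfl⟩ := Finset.mem_image.1 hzJ
        have hkS : k ∈ S := by
          by_contra h
          exact hz.2 (Finset.mem_image_of_mem a (Finset.mem_compl.2 h))
        obtain ⟨i, hi⟩ := (Finset.mem_filter.1 hk).2 hkS
        refine Finset.mem_image.2 ⟨i, Finset.mem_biUnion.2 ⟨k, hkS, ?_⟩, hi.symm⟩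
        refine Finset.mem_filter.2 ⟨Finset.mem_univ _, ?_, fun j hj => hastar_inj (hi ▸ hj)⟩
        refine M.indep_subset hA.1 (Finset.insert_subset ?_
          (Finset.image_subset_image (Finset.subset_univ _)))
        exact hi ▸ Finset.mem_image_of_mem a (Finset.mem_univ k)
      · have hne : (Tᶜ).Nonempty := by
          by_contra h
          rw [Finset.not_nonempty_iff_eq_empty, Finset.compl_eq_empty_iff] at h
          have : T.image a = Z := Finset.eq_of_subset_of_card_le hJZ (by simp [hTc, hZc, hXc, congrArg Finset.card h])
          exact hzJ (this ▸ hz.1)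
        have hm := Finset.min'_mem _ hne
        set m := Tᶜ.min' hne
        have hmS : m ∈ S ∧ ¬ ∃ i, a m = astar i := by
          simpa [T] using hm
        obtain ⟨i, -, rfl⟩ := Finset.mem_image.1
          ((Finset.mem_union.1 (hZX hz.1)).resolve_right hzJ)
        refine Finset.mem_image_of_mem _ (Finset.mem_biUnion.2 ⟨m, hmS.1, ?_⟩)
        refine Finset.mem_filter.2 ⟨Finset.mem_univ _, ?_, fun j hj => (hmS.2 ⟨j, hj⟩).elim⟩
        refine M.indep_subset hZ (Finset.insert_subset hz.1
          ((Finset.image_subset_image fun j hj => ?_).trans hJZ))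
        by_contra hjT
        exact (Finset.min'_le _ j (Finset.mem_compl.2 hjT)).not_gt (Finset.mem_filter.1 hj).2
    have h1 := Finset.card_le_card hsub
    have h2 := Finset.le_card_sdiff (Sᶜ.image a) Z
    have h3 : (Sᶜ.image a).card = K - S.card := by
      simp [Finset.card_image_of_injective _ ha_inj, Finset.card_compl]
    have h4 : S.card ≤ K := by simpa using Finset.card_le_univ S
    rw [Finset.card_image_of_injective _ hastar_inj] at h1
    omega
  obtain ⟨f, hf, hft⟩ := (Finset.all_card_le_biUnion_card_iff_exists_injective t).1 hall
  refine ⟨Equiv.ofBijective f (Finite.injective_iff_bijective.1 hf), fun k => ?_, fun k => ?_⟩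
  · exact (Finset.mem_filter.1 (hft k)).2.1
  · exact (Finset.mem_filter.1 (hft k)).2.2
end

section
/- Let Δ_1 ≥ Δ_2 ≥ ... ≥ Δ_K be a nonincreasing sequence of K positive real numbers. Then Δ_1·(1/Δ_1²) + Σ_{k=2}^K Δ_k·(1/Δ_k² − 1/Δ_{k-1}²) ≤ 2/Δ_K. -/
/-- One telescoping step; the difference of the two sides is `(1 - b / a) ^ 2 / b`. -/
theorem two_div_add_gap_le {a b : ℝ} (ha : 0 < a) (hb : 0 < b) :
    2 / a + b * (1 / b ^ 2 - 1 / a ^ 2) ≤ 2 / b := by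
  have hdiff : 2 / b - (2 / a + b * (1 / b ^ 2 - 1 / a ^ 2)) = (1 - b / a) ^ 2 / b := by
    field_simp
    ring
  have hnonneg : 0 ≤ (1 - b / a) ^ 2 / b := by positivity
  linarith

/-- For a nonincreasing sequence `Δ_1 ≥ … ≥ Δ_K` of positive reals,
`Δ_1·(1/Δ_1²) + Σ_{k=2}^K Δ_k·(1/Δ_k² − 1/Δ_{k-1}²) ≤ 2/Δ_K`. -/
theorem gap_telescoping_bound (K : ℕ) (hK : 1 ≤ K) (Δ : ℕ → ℝ)
    (hpos : ∀ k, 1 ≤ k → k ≤ K → 0 < Δ k)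
    (hmono : ∀ k, 1 ≤ k → k < K → Δ (k + 1) ≤ Δ k) :
    Δ 1 * (1 / (Δ 1) ^ 2) +
      ∑ k ∈ Finset.Icc 2 K, Δ k * (1 / (Δ k) ^ 2 - 1 / (Δ (k - 1)) ^ 2) ≤ 2 / Δ K := by
  induction K, hK using Nat.le_induction with
  | base =>
    have h1 : 0 < Δ 1 := hpos 1 le_rfl le_rfl
    have hfirst : Δ 1 * (1 / (Δ 1) ^ 2) = 1 / Δ 1 := by field_simp
    rw [Finset.Icc_eq_empty (by norm_num), Finset.sum_empty, add_zero, hfirst]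
    gcongr
    norm_num
  | succ n hn ih =>
    have hprev := ih (fun k h1 h2 => hpos k h1 (by omega)) (fun k h1 h2 => hmono k h1 (by omega))
    have hstep := two_div_add_gap_le (hpos n hn (by omega)) (hpos (n + 1) (by omega) le_rfl)
    rw [Finset.sum_Icc_succ_top (by omega), Nat.add_sub_cancel]
    linarith
end

section
/- Let n ≥ 2 be an integer and let Δ_1 ≥ Δ_2 ≥ ... ≥ Δ_m > 0 be real numbers. For each t ∈ {1, ..., n} and each k ∈ {1, ..., m}, let 1_k(t) ∈ {0, 1} be indicator values satisfying Σ_{k=1}^m 1_k(t) ≤ 1 for every t. Let T : {0, 1, ..., n} → ℕ be a counter satisfying T(0) ≥ 1 and T(t) ≥ T(t−1) + Σ_{k=1}^m 1_k(t) for all t ≥ 1. Then Σ_{t=1}^n Σ_{k=1}^m Δ_k · 1_k(t) · 1{T(t−1) ≤ (8/Δ_k²)·log n} ≤ (16/Δ_m)·log n. -/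
/-- A step of the counter below the threshold `X` is paid for by the growth of the potential
`2 * √L * √(min (x - 1) X)`. -/
lemma sqrt_div_le_potential_sub {L X x : ℝ} (hx : 1 ≤ x) (hxX : x ≤ X) :
    √L / √x ≤ 2 * √L * √(min (x + 1 - 1) X) - 2 * √L * √(min (x - 1) X) := by
  rw [min_eq_left (by linarith), min_eq_left (by linarith), add_sub_cancel_right]
  have ha : 0 < √x := Real.sqrt_pos.2 (by linarith)
  have ha2 : √x ^ 2 = x := Real.sq_sqrt (by linarith)
  have hb2 : √(x - 1) ^ 2 = x - 1 := Real.sq_sqrt (by linarith)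
  have h : 1 ≤ (2 * √x - 2 * √(x - 1)) * √x := by nlinarith [sq_nonneg (√x - √(x - 1))]
  rw [div_le_iff₀ ha]
  nlinarith [mul_le_mul_of_nonneg_left h (Real.sqrt_nonneg L)]

/-- A gap whose threshold `L / d ^ 2` has not been passed by the counter is at most `√L / √x`. -/
lemma le_sqrt_div_sqrt_of_le_div_sq {L d x : ℝ} (hd : 0 < d) (hx : 0 < x)
    (h : x ≤ L / d ^ 2) : d ≤ √L / √x := by
  rw [le_div_iff₀ (pow_pos hd 2)] at h
  rw [le_div_iff₀ (Real.sqrt_pos.2 hx)]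
  refine Real.le_sqrt_of_sq_le ?_
  rw [mul_pow, Real.sq_sqrt hx.le]
  linarith


/-- Counting bound for the regret associated with small counters. If at most one
indicator `1_k(t)` fires at each time `t`, and the counter `T` starts at at least `1`
and increases by at least the number of firing indicators, then
`Σ_{t=1}^n Σ_{k=1}^m Δ_k·1_k(t)·1{T(t−1) ≤ (8/Δ_k²)·log n} ≤ (16/Δ_m)·log n`. -/
theorem small_counter_regret_bound (n m : ℕ) (hn : 2 ≤ n) (hm : 1 ≤ m) (Δ : ℕ → ℝ)
    (hpos : ∀ k, 1 ≤ k → k ≤ m → 0 < Δ k)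
    (hmono : ∀ k, 1 ≤ k → k < m → Δ (k + 1) ≤ Δ k)
    (ind : ℕ → ℕ → ℕ)
    (hind01 : ∀ t k, ind t k ≤ 1)
    (hsum : ∀ t, ∑ k ∈ Finset.Icc 1 m, ind t k ≤ 1)
    (T : ℕ → ℕ) (hT0 : 1 ≤ T 0)
    (hTstep : ∀ t, 1 ≤ t → T (t - 1) + ∑ k ∈ Finset.Icc 1 m, ind t k ≤ T t) :
    ∑ t ∈ Finset.Icc 1 n, ∑ k ∈ Finset.Icc 1 m,
        Δ k * (ind t k : ℝ) *
          (if (T (t - 1) : ℝ) ≤ 8 / (Δ k) ^ 2 * Real.log n then 1 else 0) ≤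
      16 / Δ m * Real.log n := by
  have hlog : 0 ≤ Real.log n := Real.log_natCast_nonneg n
  have hΔm : 0 < Δ m := hpos m hm le_rfl
  have hanti : ∀ k, 1 ≤ k → k ≤ m → Δ m ≤ Δ k := by
    intro k hk hkm
    induction hkm using Nat.decreasingInduction with
    | self => exact le_rfl
    | of_succ j hj ih => exact (ih (by omega)).trans (hmono j hk hj)
  have hT1 : ∀ t, 1 ≤ T t := by
    intro t
    induction t with
    | zero => exact hT0
    | succ t ih =>
      have := hTstep (t + 1) (by omega)
      rw [Nat.add_sub_cancel] at this
      omega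
  set L : ℝ := 8 * Real.log n with hL
  have hL0 : 0 ≤ L := by positivity
  set X : ℝ := L / Δ m ^ 2 with hX
  set G : ℝ → ℝ := fun x => 2 * √L * √(min (x - 1) X) with hG
  have hGmono : Monotone G := by
    intro x y hxy
    simp only [hG]
    gcongr
  have hthr : ∀ k, 8 / Δ k ^ 2 * Real.log n = L / Δ k ^ 2 := fun k => by rw [hL]; ring
  have hstep : ∀ t, ∑ k ∈ Finset.Icc 1 m, Δ k * (ind (t + 1) k : ℝ) *
      (if (T t : ℝ) ≤ 8 / (Δ k) ^ 2 * Real.log n then 1 else 0) ≤ G (T (t + 1)) - G (T t) := by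
    intro t
    have hTt : (1 : ℝ) ≤ T t := by exact_mod_cast hT1 t
    set B : ℝ := if (T t : ℝ) ≤ X then √L / √(T t : ℝ) else 0 with hB
    have hterm : ∀ k ∈ Finset.Icc 1 m, Δ k * (ind (t + 1) k : ℝ) *
        (if (T t : ℝ) ≤ 8 / (Δ k) ^ 2 * Real.log n then 1 else 0) ≤ B * ind (t + 1) k := by
      intro k hk
      obtain ⟨hk1, hkm⟩ := Finset.mem_Icc.1 hk
      have hB0 : 0 ≤ B := by rw [hB]; split_ifs <;> positivity
      rw [hthr]
      split_ifs with h
      · have hTX : (T t : ℝ) ≤ X := h.trans (by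
          have := hanti k hk1 hkm
          rw [hX]
          gcongr)
        rw [mul_one]
        gcongr
        rw [hB, if_pos hTX]
        exact le_sqrt_div_sqrt_of_le_div_sq (hpos k hk1 hkm) (by linarith) h
      · rw [mul_zero]
        positivity
    refine (Finset.sum_le_sum hterm).trans ?_
    rw [← Finset.mul_sum, ← Nat.cast_sum]
    have hinc := hTstep (t + 1) (by omega)
    rw [Nat.add_sub_cancel] at hinc
    have hle : G (T t) ≤ G (T (t + 1)) := hGmono (by exact_mod_cast (by omega))
    rcases Nat.le_one_iff_eq_zero_or_eq_one.1 (hsum (t + 1)) with h0 | h1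
    · rw [h0, Nat.cast_zero, mul_zero]
      linarith
    · rw [h1, Nat.cast_one, mul_one, hB]
      split_ifs with h
      · have hnext : G (T t + 1) ≤ G (T (t + 1)) := hGmono (by exact_mod_cast h1 ▸ hinc)
        have hpay : √L / √(T t : ℝ) ≤ G (T t + 1) - G (T t) := sqrt_div_le_potential_sub hTt h
        linarith
      · linarith
  have hG0 : 0 ≤ G (T 0) := by positivity
  have hGn : G (T n) ≤ 16 / Δ m * Real.log n := by
    calc G (T n) ≤ 2 * √L * √X := by
          simp only [hG]
          gcongr
          exact min_le_right _ _
      _ = 2 * (√L * √L) / Δ m := by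
          rw [hX, Real.sqrt_div hL0, Real.sqrt_sq hΔm.le]
          ring
      _ = 16 / Δ m * Real.log n := by
          rw [Real.mul_self_sqrt hL0, hL]
          ring
  rw [← Finset.Ico_add_one_right_eq_Icc 1 n, Finset.sum_Ico_eq_sum_range]
  simp only [Nat.add_sub_cancel, add_comm 1]
  calc _ ≤ ∑ t ∈ Finset.range n, (G (T (t + 1)) - G (T t)) :=
        Finset.sum_le_sum fun t _ => hstep t
    _ = G (T n) - G (T 0) := Finset.sum_range_sub (fun t => G (T t)) n
    _ ≤ _ := by linarith
end

section
/- Let M = (E, I) be a matroid on a finite ground set E and let w : E → ℝ≥0 be a nonnegative weight function. Define g(X) = max{ Σ_{e ∈ Y} w(e) : Y ⊆ X, Y ∈ I } for X ⊆ E. Then g is submodular: for all X, Y ⊆ E, g(X ∪ Y) + g(X ∩ Y) ≤ g(X) + g(Y). -/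
namespace FinMatroid

variable {α : Type*} [DecidableEq α] (M : FinMatroid α)

open Classical in
/-- The maximum weight of an independent subset of `X`. -/
noncomputable def weightedRank (w : α → ℝ) (X : Finset α) : ℝ :=
  (X.powerset.filter M.Indep).sup' ⟨∅, by simp [M.empty_indep]⟩ fun Y => ∑ e ∈ Y, w e

variable {M}

lemma Indep.sum_le_weightedRank {X Y : Finset α} (hY : M.Indep Y) (hYX : Y ⊆ X) (w : α → ℝ) :
    ∑ e ∈ Y, w e ≤ M.weightedRank w X := by
  classical
  exact Finset.le_sup' (fun Y => ∑ e ∈ Y, w e) (by simp [hY, hYX])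

variable (M) in
lemma exists_weightedRank_eq_sum (w : α → ℝ) (X : Finset α) :
    ∃ Y ⊆ X, M.Indep Y ∧ M.weightedRank w X = ∑ e ∈ Y, w e := by
  classical
  obtain ⟨Y, hY, h⟩ := Finset.exists_mem_eq_sup' (s := X.powerset.filter M.Indep)
    ⟨∅, by simp [M.empty_indep]⟩ (fun Y => ∑ e ∈ Y, w e)
  rw [Finset.mem_filter, Finset.mem_powerset] at hY
  exact ⟨Y, hY.1, hY.2, h⟩

/-- A larger independent set `C` augments a smaller one `B` by an element of `C`. -/
lemma Indep.exists_insert_of_card_lt {B C : Finset α} (hB : M.Indep B) (hC : M.Indep C)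
    (h : B.card < C.card) : ∃ e ∈ C \ B, M.Indep (insert e B) := by
  obtain ⟨D, hDC, hD⟩ := Finset.exists_subset_card_eq (Nat.succ_le_of_lt h)
  obtain ⟨e, he, hi⟩ := M.augment (M.indep_subset hC hDC) hB hD.symm
  exact ⟨e, Finset.sdiff_subset_sdiff hDC subset_rfl he, hi⟩

/-- Every independent subset of `X` extends to one of maximum cardinality. -/
lemma Indep.exists_superset_card_eq {A X : Finset α} (hA : M.Indep A) (hAX : A ⊆ X) :
    ∃ B, A ⊆ B ∧ B ⊆ X ∧ M.Indep B ∧ M.weightedRank 1 X = B.card := by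
  classical
  obtain ⟨B, hB, hmax⟩ := Finset.exists_max_image
    (X.powerset.filter fun B => M.Indep B ∧ A ⊆ B) Finset.card ⟨A, by simp [hA, hAX]⟩
  simp only [Finset.mem_filter, Finset.mem_powerset] at hB hmax
  obtain ⟨hBX, hBi, hAB⟩ := hB
  refine ⟨B, hAB, hBX, hBi, le_antisymm ?_ ?_⟩
  · obtain ⟨C, hCX, hCi, hC⟩ := M.exists_weightedRank_eq_sum 1 X
    have hCB : C.card ≤ B.card := by
      by_contra! hlt
      obtain ⟨e, he, hi⟩ := hBi.exists_insert_of_card_lt hCi hlt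
      rw [Finset.mem_sdiff] at he
      have := hmax (insert e B) ⟨Finset.insert_subset (hCX he.1) hBX, hi,
        hAB.trans (Finset.subset_insert e B)⟩
      rw [Finset.card_insert_of_notMem he.2] at this
      omega
    simpa [hC] using hCB
  · simpa using hBi.sum_le_weightedRank hBX 1

variable (M) in
lemma weightedRank_one_submodular (X Y : Finset α) :
    M.weightedRank 1 (X ∪ Y) + M.weightedRank 1 (X ∩ Y) ≤
      M.weightedRank 1 X + M.weightedRank 1 Y := by
  obtain ⟨A, -, hAXY, hA, hAr⟩ := M.empty_indep.exists_superset_card_eq (X ∩ Y).empty_subset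
  obtain ⟨B, hAB, hBXY, hB, hBr⟩ := hA.exists_superset_card_eq
    (hAXY.trans (Finset.inter_subset_left.trans Finset.subset_union_left))
  have hX := (M.indep_subset hB (B.inter_subset_left (s₂ := X))).sum_le_weightedRank
    Finset.inter_subset_right 1
  have hY := (M.indep_subset hB (B.inter_subset_left (s₂ := Y))).sum_le_weightedRank
    Finset.inter_subset_right 1
  simp only [Pi.one_apply, Finset.sum_const, nsmul_eq_mul, mul_one] at hX hY
  have hunion : B ∩ X ∪ B ∩ Y = B := by
    rw [← Finset.inter_union_distrib_left, Finset.inter_eq_left.2 hBXY]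
  have hinter : A ⊆ B ∩ X ∩ (B ∩ Y) := fun e he => by
    have := hAXY he
    have := hAB he
    simp_all
  have hcard := Finset.card_union_add_card_inter (B ∩ X) (B ∩ Y)
  rw [hunion] at hcard
  have hle : B.card + A.card ≤ (B ∩ X).card + (B ∩ Y).card :=
    hcard ▸ Nat.add_le_add_left (Finset.card_le_card hinter) _
  rify at hle
  linarith

/-- Raising the weight by a constant on a set containing the support of the weight raises the
weighted rank by that multiple of the rank. -/
lemma weightedRank_add_indicator {w : α → ℝ} (hw : ∀ e, 0 ≤ w e) {m : ℝ} (hm : 0 ≤ m)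
    {S : Finset α} (hS : ∀ e ∈ M.E, e ∉ S → w e = 0) (X : Finset α) :
    M.weightedRank (fun e => w e + if e ∈ S then m else 0) X =
      M.weightedRank w X + m * M.weightedRank 1 (X ∩ S) := by
  have hsum (Y : Finset α) : ∑ e ∈ Y, (w e + if e ∈ S then m else 0) =
      ∑ e ∈ Y, w e + m * (Y ∩ S).card := by
    rw [Finset.sum_add_distrib, Finset.sum_ite_mem]
    simp [mul_comm]
  apply le_antisymm
  · obtain ⟨Y, hYX, hY, h⟩ :=
      M.exists_weightedRank_eq_sum (fun e => w e + if e ∈ S then m else 0) X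
    rw [h, hsum]
    have hr := (M.indep_subset hY (Y.inter_subset_left (s₂ := S))).sum_le_weightedRank
      (Finset.inter_subset_inter_right hYX) 1
    simp only [Pi.one_apply, Finset.sum_const, nsmul_eq_mul, mul_one] at hr
    exact add_le_add (hY.sum_le_weightedRank hYX w) (mul_le_mul_of_nonneg_left hr hm)
  · obtain ⟨Y, hYX, hY, h⟩ := M.exists_weightedRank_eq_sum w X
    obtain ⟨B, hYB, hBX, hB, hr⟩ :=
      (M.indep_subset hY (Y.inter_subset_left (s₂ := S))).exists_superset_card_eq
        (Finset.inter_subset_inter_right hYX)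
    have hle : ∑ e ∈ Y, w e ≤ ∑ e ∈ B, w e := by
      rw [← Finset.sum_subset (Y.inter_subset_left (s₂ := S)) fun e heY he =>
        hS e (M.indep_subset_ground hY heY) fun heS => he (Finset.mem_inter.2 ⟨heY, heS⟩)]
      exact Finset.sum_le_sum_of_subset_of_nonneg hYB fun e _ _ => hw e
    have hBw := hB.sum_le_weightedRank (hBX.trans Finset.inter_subset_left)
      (fun e => w e + if e ∈ S then m else 0)
    rw [hsum, Finset.inter_eq_left.2 (hBX.trans Finset.inter_subset_right)] at hBw
    rw [h, hr]
    linarith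

theorem weightedRank_submodular {w : α → ℝ} (hw : ∀ e, 0 ≤ w e) (X Y : Finset α) :
    M.weightedRank w (X ∪ Y) + M.weightedRank w (X ∩ Y) ≤
      M.weightedRank w X + M.weightedRank w Y := by
  -- Induction on a set `S` supporting `w` on the ground set, subtracting the least weight on `S`.
  obtain ⟨S, hS⟩ : ∃ S : Finset α, ∀ e ∈ M.E, e ∉ S → w e = 0 :=
    ⟨M.E, fun e he he' => absurd he he'⟩
  induction S using Finset.strongInduction generalizing w with
  | H S ih =>
    obtain rfl | hne := S.eq_empty_or_nonempty
    · have hzero (Z : Finset α) : M.weightedRank w Z = 0 := by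
        obtain ⟨I, -, hI, h⟩ := M.exists_weightedRank_eq_sum w Z
        rw [h]
        exact Finset.sum_eq_zero fun e he =>
          hS e (M.indep_subset_ground hI he) (Finset.notMem_empty e)
      simp [hzero]
    · obtain ⟨a, haS, ha⟩ := S.exists_min_image w hne
      set v : α → ℝ := fun e => w e - if e ∈ S then w a else 0 with hv
      have hv0 (e : α) : 0 ≤ v e := by
        by_cases he : e ∈ S
        · simpa [hv, he] using ha e he
        · simpa [hv, he] using hw e
      have hvS (e : α) (heE : e ∈ M.E) (he : e ∉ S) : v e = 0 := by
        simp [hv, he, hS e heE he]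
      have hdecomp (Z : Finset α) :
          M.weightedRank w Z = M.weightedRank v Z + w a * M.weightedRank 1 (Z ∩ S) := by
        rw [← weightedRank_add_indicator hv0 (hw a) hvS]
        simp [hv]
      have hvsub := ih (S.erase a) (Finset.erase_ssubset haS) hv0 fun e heE he => by
        by_cases hea : e = a
        · simp [hv, hea, haS]
        · exact hvS e heE fun heS => he (Finset.mem_erase.2 ⟨hea, heS⟩)
      have hr := mul_le_mul_of_nonneg_left
        (M.weightedRank_one_submodular (X ∩ S) (Y ∩ S)) (hw a)
      rw [← Finset.union_inter_distrib_right, ← Finset.inter_inter_distrib_right] at hr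
      simp only [hdecomp]
      linarith

end FinMatroid

/-- The weighted rank function `g(X) = max{ Σ_{e ∈ Y} w(e) : Y ⊆ X, Y independent }`
of a matroid with nonnegative weights is submodular:
`g(X ∪ Y) + g(X ∩ Y) ≤ g(X) + g(Y)`. -/
theorem weighted_rank_submodular {α : Type*} [DecidableEq α] (M : FinMatroid α)
    (w : α → ℝ) (hw : ∀ e, 0 ≤ w e)
    (g : Finset α → ℝ)
    (hg : ∀ X : Finset α,
      IsGreatest {r : ℝ | ∃ Y : Finset α, Y ⊆ X ∧ M.Indep Y ∧ r = ∑ e ∈ Y, w e} (g X)) :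
    ∀ X Y : Finset α, X ⊆ M.E → Y ⊆ M.E → g (X ∪ Y) + g (X ∩ Y) ≤ g X + g Y := by
  intro X Y _ _
  have hgr (Z : Finset α) : g Z = M.weightedRank w Z := by
    apply (hg Z).unique
    refine ⟨M.exists_weightedRank_eq_sum w Z, ?_⟩
    rintro _ ⟨I, hIZ, hI, rfl⟩
    exact hI.sum_le_weightedRank hIZ w
  simp only [hgr]
  exact FinMatroid.weightedRank_submodular hw X Y
end
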